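/- Let m = ⌊N/3⌋ and let 𝒮 be a finite set with m^{1/4} < log₂|𝒮| < N/12. For every sufficiently large N and every integer k with 2 ≤ k ≤ N/(6·log₂|𝒮|), one has r_k(m,𝒮) ≥ (4/9)·√(N·(log C(N, k) + k·log|𝒮|)). -/

import Mathlib

/-- `P(S(m,1/2) ≥ x)` for a binomial random variable `S(m,1/2)` with parameters
`m` and `1/2`, i.e. `P(S(m,1/2) = j) = C(m,j)/2^m` for `0 ≤ j ≤ m`. -/
noncomputable def binomialUpperTail (m : ℕ) (x : ℝ) : ℝ :=
  (∑ j ∈ Finset.range (m + 1), if x ≤ (j : ℝ) then (m.choose j : ℝ) else 0) / 2 ^ m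

/-- For `m = ⌊N/3⌋` and a seed set of size `s` (large seed sets), `r_k(m,𝒮)` is the
maximal `r ∈ ℕ` with `P(S(m,1/2) ≥ (m+r)/2) ≥ k² log N / ((m+1)^(k-1)·C(s,k))`. -/
noncomputable def rkLarge (N k s : ℕ) : ℕ :=
  sSup {r : ℕ |
    ((k : ℝ) ^ 2 * Real.log N) / (((N / 3 + 1 : ℕ) : ℝ) ^ (k - 1) * (s.choose k : ℝ)) ≤
      binomialUpperTail (N / 3) ((((N / 3 : ℕ) : ℝ) + (r : ℝ)) / 2)}

/-- The upper half of Stirling's estimate, in logarithmic form. -/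
theorem Real.log_factorial_le {n : ℕ} (hn : 1 ≤ n) :
    Real.log n.factorial ≤ n * Real.log n - n + 1 + Real.log n := by
  induction n, hn using Nat.le_induction with
  | base => simp
  | succ n hn ih =>
    have hn' : (0 : ℝ) < n := by exact_mod_cast hn
    have hlog := Real.one_sub_inv_le_log_of_pos (show (0 : ℝ) < (n + 1) / n by positivity)
    rw [Real.log_div (by positivity) (by positivity), inv_div, one_sub_div (by positivity),
      add_sub_cancel_left, div_le_iff₀ (by positivity)] at hlog
    rw [Nat.factorial_succ]
    push_cast
    rw [Real.log_mul (by positivity) (by positivity)]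
    linarith

/-- A weak Stirling upper bound whose error term depends only on a bound for `n`. -/
theorem Real.log_factorial_le_of_le {n m : ℕ} (hnm : n ≤ m) :
    Real.log n.factorial ≤ n * Real.log n - n + 1 + Real.log m := by
  have hlogm : 0 ≤ Real.log m := Real.log_natCast_nonneg m
  rcases Nat.eq_zero_or_pos n with rfl | hn
  · simp only [Nat.factorial_zero, Nat.cast_one, Real.log_one, Nat.cast_zero]
    linarith
  · have : Real.log n ≤ Real.log m := Real.log_le_log (by exact_mod_cast hn) (by exact_mod_cast hnm)
    linarith [Real.log_factorial_le hn]

theorem Real.mul_log_sub_log_le {x y : ℝ} (hx : 0 ≤ x) (hy : 0 < y) :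
    x * Real.log x - x * Real.log y ≤ x * (x / y - 1) := by
  rcases hx.eq_or_lt with rfl | hx
  · simp
  · rw [← mul_sub, ← Real.log_div hx.ne' hy.ne']
    gcongr
    exact Real.log_le_sub_one_of_pos (by positivity)

/-- A Gaussian-type lower bound for a binomial point probability. -/
theorem log_choose_ge {m j : ℕ} (hm : 1 ≤ m) (hj : j ≤ m) :
    m * Real.log 2 - (2 * j - m : ℝ) ^ 2 / m - 2 - 2 * Real.log m ≤ Real.log (m.choose j) := by
  obtain ⟨i, rfl⟩ := Nat.exists_eq_add_of_le hj
  have hM : (0 : ℝ) < (j + i : ℕ) := by exact_mod_cast hm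
  have hfac : Real.log (j + i).factorial =
      Real.log ((j + i).choose j) + Real.log j.factorial + Real.log i.factorial := by
    have hc := Nat.choose_pos hj
    rw [← Nat.choose_mul_factorial_mul_factorial hj, Nat.add_sub_cancel_left]
    push_cast
    rw [Real.log_mul (by positivity) (by positivity), Real.log_mul (by positivity) (by positivity)]
  have hlow : ((j + i : ℕ) : ℝ) * Real.log (j + i : ℕ) - (j + i : ℕ)
      ≤ Real.log (j + i).factorial := by
    have := Stirling.le_log_factorial_stirling (n := j + i) (by omega)
    have h2 : 0 ≤ Real.log (j + i : ℕ) := Real.log_natCast_nonneg _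
    have h3 : 0 ≤ Real.log (2 * Real.pi) := Real.log_nonneg (by linarith [Real.pi_gt_three])
    linarith
  have hupj := Real.log_factorial_le_of_le (Nat.le_add_right j i)
  have hupi := Real.log_factorial_le_of_le (Nat.le_add_left i j)
  have hentj := Real.mul_log_sub_log_le (Nat.cast_nonneg j) (half_pos hM)
  have henti := Real.mul_log_sub_log_le (Nat.cast_nonneg i) (half_pos hM)
  rw [Real.log_div hM.ne' two_ne_zero] at hentj henti
  have hsum : (j : ℝ) * (j / ((j + i : ℕ) / 2) - 1) + i * (i / ((j + i : ℕ) / 2) - 1)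
      = (2 * j - (j + i : ℕ) : ℝ) ^ 2 / (j + i : ℕ) := by
    field_simp
    push_cast
    ring
  rw [← hsum]
  push_cast at *
  linarith

theorem choose_div_two_pow_le_binomialUpperTail {m j : ℕ} {x : ℝ} (hj : j ≤ m) (hx : x ≤ j) :
    (m.choose j : ℝ) / 2 ^ m ≤ binomialUpperTail m x := by
  unfold binomialUpperTail
  gcongr
  have := Finset.single_le_sum (f := fun j : ℕ => if x ≤ (j : ℝ) then (m.choose j : ℝ) else 0)
    (fun i _ => by positivity) (Finset.mem_range.2 (Nat.lt_succ_of_le hj))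
  simpa [hx] using this

theorem binomialUpperTail_eq_zero {m : ℕ} {x : ℝ} (hx : (m : ℝ) < x) :
    binomialUpperTail m x = 0 := by
  unfold binomialUpperTail
  rw [Finset.sum_eq_zero, zero_div]
  intro j hj
  have : (j : ℝ) ≤ m := by exact_mod_cast Nat.lt_succ_iff.1 (Finset.mem_range.1 hj)
  exact if_neg (by linarith)

/-- A positive threshold makes the set defining `rkLarge` bounded, so any element is a lower
bound. -/
theorem le_rkLarge {N k s r : ℕ} (hk : 0 < k) (hN : 1 < N) (hks : k ≤ s)
    (hr : ((k : ℝ) ^ 2 * Real.log N) / (((N / 3 + 1 : ℕ) : ℝ) ^ (k - 1) * (s.choose k : ℝ)) ≤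
      binomialUpperTail (N / 3) ((((N / 3 : ℕ) : ℝ) + (r : ℝ)) / 2)) :
    r ≤ rkLarge N k s := by
  refine le_csSup ⟨N / 3, fun q hq => ?_⟩ hr
  by_contra! hlt
  have hlog : 0 < Real.log N := Real.log_pos (by exact_mod_cast hN)
  have hc := Nat.choose_pos hks
  have hpos : 0 < ((k : ℝ) ^ 2 * Real.log N) /
      (((N / 3 + 1 : ℕ) : ℝ) ^ (k - 1) * (s.choose k : ℝ)) := by positivity
  have hlt' : ((N / 3 : ℕ) : ℝ) < q := by exact_mod_cast hlt
  have hq' := hpos.trans_le hq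
  rw [binomialUpperTail_eq_zero (by linarith)] at hq'
  exact hq'.false

/-- It suffices to compare logarithms; `r + 1` in place of `r` absorbs the parity of `m + r`. -/
theorem le_rkLarge_of_log_le {N k s r : ℕ} (hk : 2 ≤ k) (hkN : 2 * k ≤ N) (hN : 3 ≤ N) (hNs : N ≤ s)
    (hr : r + 1 ≤ N / 3)
    (h : (r + 1 : ℝ) ^ 2 / (N / 3 : ℕ) + 2 + 2 * Real.log N + 3 * Real.log N + k * Real.log N
      ≤ k * Real.log s) :
    r ≤ rkLarge N k s := by
  have hks : k ≤ s := by omega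
  refine le_rkLarge (by omega) (by omega) hks ?_
  set m := N / 3 with hm
  have hm1 : 1 ≤ m := by omega
  have hm0 : (0 : ℝ) < m := by exact_mod_cast hm1
  obtain ⟨j, hj1, hj2⟩ : ∃ j, m + r ≤ 2 * j ∧ 2 * j ≤ m + r + 1 := ⟨(m + r + 1) / 2, by omega, by omega⟩
  have hj1' : (m + r : ℝ) ≤ 2 * j := by exact_mod_cast hj1
  have hj2' : (2 * j : ℝ) ≤ m + r + 1 := by exact_mod_cast hj2
  have hjm : j ≤ m := by omega
  refine le_trans ?_ (choose_div_two_pow_le_binomialUpperTail hjm (by linarith))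
  have hN1 : (1 : ℝ) < N := by exact_mod_cast (by omega : 1 < N)
  have hN0 : (0 : ℝ) < N := by linarith
  have hk0 : (0 : ℝ) < k := by exact_mod_cast (by omega : 0 < k)
  have hs0 : (0 : ℝ) < s := by exact_mod_cast (by omega : 0 < s)
  have hlogN : 0 < Real.log N := Real.log_pos hN1
  have hmj := Nat.choose_pos hjm
  have hsk := Nat.choose_pos hks
  have hsq : (2 * j - m : ℝ) ^ 2 / m ≤ (r + 1 : ℝ) ^ 2 / m := by
    gcongr <;> linarith
  have hlogm : Real.log m ≤ Real.log N :=
    Real.log_le_log hm0 (by exact_mod_cast Nat.div_le_self N 3)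
  have hlogk : Real.log k ≤ Real.log N := Real.log_le_log hk0 (by exact_mod_cast (by omega : k ≤ N))
  have hloglog : Real.log (Real.log N) ≤ Real.log N :=
    (Real.log_le_sub_one_of_pos hlogN).trans (by linarith)
  have hchoose : k * Real.log s - k * Real.log N ≤ Real.log (s.choose k) := by
    have hpow : ((s : ℝ) / N) ^ k ≤ s.choose k := by
      refine le_trans ?_ (Nat.pow_le_choose k s)
      have hhalf : (s : ℝ) ≤ 2 * (s + 1 - k : ℕ) := by
        exact_mod_cast (by omega : s ≤ 2 * (s + 1 - k))
      have hkN' : (2 * k : ℝ) ≤ N := by exact_mod_cast hkN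
      have hfac : (k.factorial : ℝ) ≤ (k : ℝ) ^ k := by exact_mod_cast Nat.factorial_le_pow k
      have hbase : (s : ℝ) / N ≤ (s + 1 - k : ℕ) / k := by
        rw [div_le_div_iff₀ hN0 hk0]
        nlinarith
      calc ((s : ℝ) / N) ^ k ≤ ((s + 1 - k : ℕ) / k) ^ k := by gcongr
        _ = ((s + 1 - k : ℕ) : ℝ) ^ k / (k : ℝ) ^ k := div_pow _ _ _
        _ ≤ ((s + 1 - k : ℕ) ^ k : ℝ) / k.factorial := by gcongr
    have := Real.log_le_log (by positivity) hpow
    rw [Real.log_pow, Real.log_div hs0.ne' hN0.ne'] at this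
    linarith
  have hpow1 : (0 : ℝ) ≤ Real.log (((m + 1 : ℕ) : ℝ) ^ (k - 1)) :=
    Real.log_nonneg (one_le_pow₀ (by push_cast; linarith))
  rw [← Real.log_le_log_iff (by positivity) (by positivity),
    Real.log_div (by positivity) (by positivity), Real.log_div (by positivity) (by positivity),
    Real.log_mul (by positivity) (by positivity), Real.log_mul (by positivity) (by positivity)]
  simp only [Real.log_pow] at hpow1 ⊢
  have := log_choose_ge hm1 hjm
  push_cast at *
  linarith

theorem eventually_log_le_rpow_div_three :
    ∀ᶠ N : ℕ in Filter.atTop,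
      30 * Real.log N ≤ ((N / 3 : ℕ) : ℝ) ^ ((1 : ℝ) / 4) * Real.log 2 := by
  have hdiv : Filter.Tendsto (fun N : ℕ => ((N / 3 : ℕ) : ℝ)) Filter.atTop Filter.atTop :=
    tendsto_natCast_atTop_atTop.comp (Nat.tendsto_div_const_atTop (by norm_num))
  have hlo := ((isLittleO_log_rpow_atTop (show (0 : ℝ) < 1 / 4 by norm_num)).comp_tendsto
    hdiv).bound (show (0 : ℝ) < Real.log 2 / 60 by have := Real.log_pos one_lt_two; positivity)
  filter_upwards [hlo, Filter.eventually_ge_atTop 100] with N hN hN100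
  have hm : (5 : ℝ) ≤ (N / 3 : ℕ) := by exact_mod_cast (by omega : 5 ≤ N / 3)
  have hsq : (N : ℝ) ≤ ((N / 3 : ℕ) : ℝ) ^ 2 := by
    have : N ≤ 5 * (N / 3) := by omega
    have : (N : ℝ) ≤ 5 * (N / 3 : ℕ) := by exact_mod_cast this
    nlinarith
  have hlog := Real.log_le_log (by positivity) hsq
  rw [Real.log_pow] at hlog
  simp only [Function.comp_apply, Real.norm_eq_abs] at hN
  rw [abs_of_nonneg (Real.log_natCast_nonneg _), abs_of_nonneg (by positivity)] at hN
  push_cast at hlog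
  linarith

/-- Let `m = ⌊N/3⌋` and `𝒮` finite with `m^(1/4) < log₂|𝒮| < N/12`. For every sufficiently
large `N` and every `k` with `2 ≤ k ≤ N/(6 log₂|𝒮|)`,
`r_k(m,𝒮) ≥ (4/9)·√(N(log C(N,k) + k log|𝒮|))`. -/
theorem rk_lower_bound_large_seed_set :
    ∃ N₀ : ℕ, ∀ N : ℕ, N₀ ≤ N → ∀ (S : Type) [Fintype S],
      ((N / 3 : ℕ) : ℝ) ^ ((1 : ℝ) / 4) < Real.logb 2 (Fintype.card S) →
      Real.logb 2 (Fintype.card S) < (N : ℝ) / 12 →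
      ∀ k : ℕ, 2 ≤ k → (k : ℝ) ≤ (N : ℝ) / (6 * Real.logb 2 (Fintype.card S)) →
        (4 / 9) * Real.sqrt ((N : ℝ) *
            (Real.log (N.choose k : ℝ) + k * Real.log (Fintype.card S))) ≤
          (rkLarge N k (Fintype.card S) : ℝ) := by
  obtain ⟨N₁, hN₁⟩ := Filter.eventually_atTop.1 eventually_log_le_rpow_div_three
  refine ⟨max N₁ 200, fun N hN S _ hS _ k hk hkS => ?_⟩
  have hN200 : 200 ≤ N := (le_max_right _ _).trans hN
  have hNr : (200 : ℝ) ≤ N := by exact_mod_cast hN200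
  have hkr : (2 : ℝ) ≤ k := by exact_mod_cast hk
  set s := Fintype.card S
  have hlog2 : 0 < Real.log 2 := Real.log_pos one_lt_two
  have hlogN : 1 ≤ Real.log N := by
    rw [Real.le_log_iff_exp_le (by linarith)]
    linarith [Real.exp_one_lt_three]
  have hlogbs : Real.logb 2 s * Real.log 2 = Real.log s :=
    div_mul_cancel₀ _ hlog2.ne'
  have hlogs : 30 * Real.log N ≤ Real.log s := by
    have := hN₁ N ((le_max_left _ _).trans hN)
    nlinarith
  have hlogb : 1 ≤ Real.logb 2 s := by
    have : Real.log 2 < 1 := Real.log_two_lt_d9.trans (by norm_num)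
    by_contra! h
    nlinarith
  have hNs : N ≤ s := by
    by_contra! h
    rcases Nat.eq_zero_or_pos s with h0 | h0
    · rw [h0] at hlogs
      simp at hlogs
      linarith
    · have := Real.log_le_log (by exact_mod_cast h0) (Nat.cast_le (α := ℝ).2 h.le)
      linarith
  rw [le_div_iff₀ (by positivity)] at hkS
  have hklogs : k * Real.log s ≤ N * (7 / 60) := by
    have : Real.log 2 ≤ 7 / 10 := Real.log_two_lt_d9.le.trans (by norm_num)
    rw [← hlogbs]
    nlinarith
  have h2kN : 2 * k ≤ N := by
    have : (2 * k : ℝ) ≤ N := by nlinarith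
    exact_mod_cast this
  have hkN : k ≤ N := by omega
  have hchoose : Real.log (N.choose k) ≤ k * Real.log N := by
    have hc := Nat.choose_pos hkN
    rw [← Real.log_pow]
    exact Real.log_le_log (by positivity) (by exact_mod_cast Nat.choose_le_pow N k)
  have hchoose0 : 0 ≤ Real.log (N.choose k) := Real.log_natCast_nonneg _
  set T := Real.log (N.choose k) + k * Real.log s
  have hklog : 30 * (k * Real.log N) ≤ k * Real.log s := by nlinarith
  have hT : T ≤ k * Real.log N + k * Real.log s := by simp only [T]; linarith
  have hT0 : 0 ≤ T := by simp only [T]; positivity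
  have hTN : T ≤ N / 4 := by linarith
  set R := Real.sqrt (N * T) with hR
  have hR0 : 0 ≤ R := Real.sqrt_nonneg _
  have hRsq : R ^ 2 = N * T := Real.sq_sqrt (by positivity)
  have hRN : R ≤ N / 2 := Real.sqrt_le_iff.2 ⟨by positivity, by nlinarith⟩
  set r := ⌈4 / 9 * R⌉₊
  have hr : (r : ℝ) < 4 / 9 * R + 1 := Nat.ceil_lt_add_one (by positivity)
  refine (Nat.le_ceil _).trans (Nat.cast_le.2 ?_)
  have hm : (N : ℝ) ≤ 3 * (N / 3 : ℕ) + 2 := by exact_mod_cast (by omega : N ≤ 3 * (N / 3) + 2)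
  refine le_rkLarge_of_log_le hk h2kN (by omega) hNs ?_ ?_
  · have : (r + 1 : ℝ) ≤ (N / 3 : ℕ) := by linarith
    exact_mod_cast this
  · have hd : (r + 1 : ℝ) ^ 2 / (N / 3 : ℕ) ≤ 3 / 5 * T + 10 := by
      rw [div_le_iff₀ (by linarith)]
      have h1 : (r + 1 : ℝ) ^ 2 ≤ (4 / 9 * R + 2) ^ 2 :=
        pow_le_pow_left₀ (by positivity) (by linarith) 2
      nlinarith
    nlinarith
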